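/- Let d ≥ 3, 1 ≤ k ≤ d−2, ε > 0, and let u₁,…,u_k ∈ ℚ^d be linearly independent rational vectors. There exists a constant C, depending on d, k, ε and on u₁,…,u_k but independent of λ, such that for every λ ≥ 1, every x₀ ∈ ℝ^d, and every choice of complex coefficients (c_n)_{n∈E} with E = {n ∈ ℤ^d : |n| = λ}, one has ∫_{[−1,1]^k} |Σ_{n∈E} c_n e^{i n·(x₀ + Σ_j t_j u_j)}|² √(det[u_i·u_j]_{k×k}) dt ≤ C · λ^{d−k−2+ε} · Σ_{n∈E} |c_n|². That is, for a rational totally geodesic submanifold Σ of dimension k ≤ d−2, ‖e_λ‖_{L²(Σ)} ≲ λ^{(d−k−2)/2+ε} ‖e_λ‖_{L²(T^d)}. -/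

import Mathlib

open MeasureTheory

/-- Dot product of a lattice point `n ∈ ℤ^d` with a real vector `x ∈ ℝ^d`. -/
noncomputable def dotIR {d : ℕ} (n : Fin d → ℤ) (x : Fin d → ℝ) : ℝ :=
  ∑ i, (n i : ℝ) * x i


lemma divisor_bound (δ : ℝ) (hδ : 0 < δ) :
    ∃ C : ℝ, 1 ≤ C ∧ ∀ n : ℕ, n ≠ 0 → (n.divisors.card : ℝ) ≤ C * (n : ℝ) ^ δ := by
  obtain ⟨P, hP⟩ := exists_nat_ge ((2 : ℝ) ^ (1 / δ))
  set K : ℝ := 1 + 1 / (δ * Real.log 2) with hK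
  have hl : 0 < δ * Real.log 2 := mul_pos hδ (Real.log_pos (by norm_num))
  have hK1 : 1 ≤ K := by rw [hK]; have := one_div_pos.mpr hl; linarith
  refine ⟨K ^ P, one_le_pow₀ hK1, fun n hn => ?_⟩
  have hpt : ∀ p ∈ n.primeFactors, ((n.factorization p + 1 : ℕ) : ℝ) ≤
      (if p < P then K else 1) * ((p : ℝ) ^ (n.factorization p)) ^ δ := by
    intro p hp
    set a := n.factorization p
    have hp2 : 2 ≤ p := (Nat.prime_of_mem_primeFactors hp).two_le
    have hp2' : (2 : ℝ) ≤ p := by exact_mod_cast hp2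
    have e1 : ((p : ℝ) ^ a) ^ δ = ((p : ℝ) ^ δ) ^ a := by
      rw [← Real.rpow_natCast, ← Real.rpow_natCast, ← Real.rpow_mul (by positivity),
        ← Real.rpow_mul (by positivity), mul_comm]
    rw [e1]
    split_ifs with h
    · have h1 : (1 : ℝ) + δ * Real.log 2 ≤ (p : ℝ) ^ δ := by
        calc (1 : ℝ) + δ * Real.log 2 ≤ Real.exp (δ * Real.log 2) := by
              have := Real.add_one_le_exp (δ * Real.log 2); linarith
          _ = (2 : ℝ) ^ δ := by rw [Real.rpow_def_of_pos (by norm_num), mul_comm]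
          _ ≤ _ := Real.rpow_le_rpow (by norm_num) hp2' hδ.le
      have h2 : 1 + (a : ℝ) * (δ * Real.log 2) ≤ ((p : ℝ) ^ δ) ^ a := by
        calc _ ≤ (1 + δ * Real.log 2) ^ a := one_add_mul_le_pow (by linarith) a
          _ ≤ _ := pow_le_pow_left₀ (by linarith) h1 a
      calc ((a + 1 : ℕ) : ℝ) ≤ K * (1 + (a : ℝ) * (δ * Real.log 2)) := by
            have : K * (1 + (a : ℝ) * (δ * Real.log 2)) =
              1 + a + 1 / (δ * Real.log 2) + a * (δ * Real.log 2) := by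
              rw [hK]; field_simp; ring
            rw [this]; push_cast
            have := one_div_pos.mpr hl
            have : 0 ≤ (a : ℝ) * (δ * Real.log 2) := by positivity
            linarith
        _ ≤ _ := mul_le_mul_of_nonneg_left h2 (by linarith)
    · have h1 : (2 : ℝ) ≤ (p : ℝ) ^ δ := by
        have : ((2 : ℝ) ^ (1 / δ)) ^ δ = 2 := by
          rw [← Real.rpow_mul (by norm_num)]; field_simp; simp
        calc (2 : ℝ) = ((2 : ℝ) ^ (1 / δ)) ^ δ := this.symm
          _ ≤ _ := Real.rpow_le_rpow (by positivity)
            (hP.trans (by exact_mod_cast not_lt.mp h)) hδ.le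
      rw [one_mul]
      calc ((a + 1 : ℕ) : ℝ) ≤ (2 : ℝ) ^ a := by exact_mod_cast Nat.lt_two_pow_self
        _ ≤ _ := pow_le_pow_left₀ (by norm_num) h1 a
  rw [Nat.card_divisors hn, Nat.cast_prod]
  calc _ ≤ ∏ p ∈ n.primeFactors, ((if p < P then K else 1) * ((p : ℝ) ^ (n.factorization p)) ^ δ) :=
        Finset.prod_le_prod (fun _ _ => by positivity) hpt
    _ = (∏ p ∈ n.primeFactors, (if p < P then K else 1)) * (n : ℝ) ^ δ := by
        rw [Finset.prod_mul_distrib, Real.finsetProd_rpow _ _ (fun _ _ => by positivity)]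
        congr 2
        conv_rhs => rw [← Nat.prod_factorization_pow_eq_self hn]
        rw [Finsupp.prod]; push_cast; rfl
    _ ≤ _ := by
        apply mul_le_mul_of_nonneg_right _ (by positivity)
        rw [Finset.prod_ite, Finset.prod_const, Finset.prod_const_one, mul_one]
        apply pow_le_pow_right₀ hK1
        calc _ ≤ (Finset.range P).card := Finset.card_le_card (fun x hx => by
              simp at hx ⊢; exact hx.2)
          _ = P := by simp

lemma class_bound (D : ℤ) (hD : 0 < D) (M : ℤ) (hM : 0 < M) (S : Finset (ℤ × ℤ))
    (hS : ∀ z ∈ S, z.1 ^ 2 + D * z.2 ^ 2 = M)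
    (hd : ∀ z ∈ S, ∀ w ∈ S, M ∣ 2 * D * (z.1 * w.2 - z.2 * w.1)) :
    S.card ≤ (4 * D + 1).toNat * 2 := by
  rcases S.eq_empty_or_nonempty with rfl | ⟨w, hw⟩
  · simp
  have hww := hS w hw
  have key : ∀ z ∈ S, (z.1 * w.1 + D * z.2 * w.2) ^ 2 + D * (z.1 * w.2 - z.2 * w.1) ^ 2 = M ^ 2 := by
    intro z hz
    have := hS z hz
    calc _ = (z.1 ^ 2 + D * z.2 ^ 2) * (w.1 ^ 2 + D * w.2 ^ 2) := by ring
      _ = M ^ 2 := by rw [this, hww]; ring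
  have := Finset.card_le_card_of_injOn (s := S)
    (t := (Finset.Icc (-(2 * D)) (2 * D)) ×ˢ (Finset.univ : Finset Bool))
    (fun z => (2 * D * (z.1 * w.2 - z.2 * w.1) / M, decide (0 ≤ z.1 * w.1 + D * z.2 * w.2))) ?_ ?_
  · refine this.trans ?_
    rw [Finset.card_product, Int.card_Icc]
    apply Nat.mul_le_mul _ (by simp)
    apply Int.toNat_le_toNat; linarith
  · intro z hz
    have hz : z ∈ S := hz
    have h1 := key z hz
    obtain ⟨t, ht⟩ := hd z hz w hw
    simp only [Finset.coe_product, Set.mem_prod, Finset.mem_coe, Finset.mem_univ, and_true]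
    rw [ht, Int.mul_ediv_cancel_left _ hM.ne', Finset.mem_Icc, ← abs_le]
    have h2 : (z.1 * w.2 - z.2 * w.1) ^ 2 ≤ M ^ 2 := by
      nlinarith [sq_nonneg (z.1 * w.1 + D * z.2 * w.2), sq_nonneg (z.1 * w.2 - z.2 * w.1)]
    have h3 : |z.1 * w.2 - z.2 * w.1| ≤ M := abs_le_of_sq_le_sq h2 hM.le
    have h4 : M * |t| = 2 * D * |z.1 * w.2 - z.2 * w.1| := by
      have := congrArg abs ht
      rw [abs_mul, abs_mul M, abs_of_pos hM, abs_of_pos (by linarith : 0 < 2 * D)] at this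
      exact this.symm
    nlinarith
  · intro z hz z' hz' heq
    have hz : z ∈ S := hz
    have hz' : z' ∈ S := hz'
    simp only [Prod.mk.injEq, decide_eq_decide] at heq
    obtain ⟨e1, e2⟩ := heq
    have hdet : z.1 * w.2 - z.2 * w.1 = z'.1 * w.2 - z'.2 * w.1 := by
      obtain ⟨t, ht⟩ := hd z hz w hw
      obtain ⟨t', ht'⟩ := hd z' hz' w hw
      rw [ht, ht', Int.mul_ediv_cancel_left _ hM.ne', Int.mul_ediv_cancel_left _ hM.ne'] at e1
      rw [e1, ← ht'] at ht
      exact mul_left_cancel₀ (by linarith : (2 * D) ≠ 0) ht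
    have k1 := key z hz
    have k2 := key z' hz'
    have hre : z.1 * w.1 + D * z.2 * w.2 = z'.1 * w.1 + D * z'.2 * w.2 := by
      have hsq : (z.1 * w.1 + D * z.2 * w.2) ^ 2 = (z'.1 * w.1 + D * z'.2 * w.2) ^ 2 := by
        rw [hdet] at k1; linarith
      rcases sq_eq_sq_iff_eq_or_eq_neg.mp hsq with h | h
      · exact h
      · by_cases hp : 0 ≤ z.1 * w.1 + D * z.2 * w.2
        · have := e2.mp hp; linarith
        · have := mt e2.mpr hp; linarith
    have hY : M * z.1 = M * z'.1 := by
      rw [← hww]; linear_combination w.1 * hre + D * w.2 * hdet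
    have hX : M * z.2 = M * z'.2 := by
      rw [← hww]; linear_combination w.2 * hre - w.1 * hdet
    exact Prod.ext (mul_left_cancel₀ hM.ne' hY) (mul_left_cancel₀ hM.ne' hX)

lemma prim_bound (D : ℤ) (hD : 0 < D) (M : ℤ) (hM : 0 < M) (S : Finset (ℤ × ℤ))
    (hS : ∀ z ∈ S, z.1 ^ 2 + D * z.2 ^ 2 = M) (w : ℤ × ℤ) (hw : w ∈ S) (hc : IsCoprime M w.2) :
    S.card ≤ (4 * D + 1).toNat * 2 * M.natAbs.divisors.card := by
  have hww := hS w hw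
  refine (Finset.card_le_mul_card_image (f := fun z : ℤ × ℤ => Int.gcd M (z.1 * w.2 - z.2 * w.1)) S
    ((4 * D + 1).toNat * 2) ?_).trans ?_
  · intro g hg
    have hg0 : (g : ℤ) ≠ 0 := by
      obtain ⟨z, -, rfl⟩ := Finset.mem_image.mp hg
      simp [Int.gcd_eq_zero_iff, hM.ne']
    have hgM : (g : ℤ) ∣ M := by
      obtain ⟨z, -, rfl⟩ := Finset.mem_image.mp hg
      exact Int.gcd_dvd_left _ _
    obtain ⟨h, hh⟩ := hgM
    have hz : ∀ z ∈ S, Int.gcd M (z.1 * w.2 - z.2 * w.1) = g →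
        (g : ℤ) ∣ (z.1 * w.2 - z.2 * w.1) ∧ h ∣ (z.1 * w.2 + z.2 * w.1) := by
      intro z hz hzg
      have h1 := hS z hz
      refine ⟨hzg ▸ Int.gcd_dvd_right _ _, ?_⟩
      have hb := Int.gcd_eq_gcd_ab M (z.1 * w.2 - z.2 * w.1)
      rw [hzg] at hb
      have : (g : ℤ) * h ∣ g * (z.1 * w.2 + z.2 * w.1) := by
        rw [← hh]
        nth_rewrite 1 [hb]
        have hAB : (z.1 * w.2 - z.2 * w.1) * (z.1 * w.2 + z.2 * w.1) = M * (w.2 ^ 2 - z.2 ^ 2) := by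
          linear_combination w.2 ^ 2 * h1 - z.2 ^ 2 * hww
        rw [add_mul]
        refine dvd_add (by rw [mul_assoc]; exact dvd_mul_right _ _) ?_
        rw [mul_right_comm, hAB, mul_assoc]
        exact dvd_mul_right _ _
      exact (mul_dvd_mul_iff_left hg0).mp this
    apply class_bound D hD M hM
    · intro z hz'
      exact hS z (Finset.mem_filter.mp hz').1
    · intro z hz1 y hy1
      obtain ⟨hzS, hzg⟩ := Finset.mem_filter.mp hz1
      obtain ⟨hyS, hyg⟩ := Finset.mem_filter.mp hy1
      obtain ⟨⟨a, ha⟩, ⟨b, hb⟩⟩ := hz z hzS hzg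
      obtain ⟨⟨a', ha'⟩, ⟨b', hb'⟩⟩ := hz y hyS hyg
      have e1 : M ∣ w.2 * (2 * w.1 * (z.1 * y.2 - z.2 * y.1)) := by
        refine ⟨a * b' - b * a', ?_⟩
        calc _ = (z.1 * w.2 - z.2 * w.1) * (y.1 * w.2 + y.2 * w.1)
              - (z.1 * w.2 + z.2 * w.1) * (y.1 * w.2 - y.2 * w.1) := by ring
          _ = _ := by rw [ha, hb, ha', hb', hh]; ring
      have e2 := hc.dvd_of_dvd_mul_left e1
      have e3 : M ∣ w.2 * (w.2 * (2 * D * (z.1 * y.2 - z.2 * y.1))) := by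
        have : w.2 * (w.2 * (2 * D * (z.1 * y.2 - z.2 * y.1))) =
          M * (2 * (z.1 * y.2 - z.2 * y.1)) - (2 * w.1 * (z.1 * y.2 - z.2 * y.1)) * w.1 := by
          rw [← hww]; ring
        rw [this]
        exact dvd_sub (dvd_mul_right _ _) (e2.mul_right _)
      exact hc.dvd_of_dvd_mul_left (hc.dvd_of_dvd_mul_left e3)
  · apply Nat.mul_le_mul_left
    apply Finset.card_le_card
    intro g hg
    obtain ⟨z, -, rfl⟩ := Finset.mem_image.mp hg
    rw [Nat.mem_divisors]
    exact ⟨Nat.gcd_dvd_left _ _, by simpa using hM.ne'⟩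

lemma conic_bound (D : ℤ) (hD : 0 < D) (M : ℤ) (hM : 0 < M) (S : Finset (ℤ × ℤ))
    (hS : ∀ z ∈ S, z.1 ^ 2 + D * z.2 ^ 2 = M) :
    S.card ≤ (4 * D + 1).toNat * 2 * M.natAbs.divisors.card * M.natAbs.divisors.card := by
  refine (Finset.card_le_mul_card_image (f := fun z : ℤ × ℤ => Int.gcd z.1 z.2) S
    ((4 * D + 1).toNat * 2 * M.natAbs.divisors.card) ?_).trans ?_
  · intro e he
    obtain ⟨w, hw, hwe⟩ := Finset.mem_image.mp he
    have hww := hS w hw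
    have he0 : (e : ℤ) ≠ 0 := by
      rw [← hwe]
      intro h0
      have h0' := Int.gcd_eq_zero_iff.mp (Int.natCast_eq_zero.mp h0)
      rw [h0'.1, h0'.2] at hww
      simp at hww
      omega
    have hdiv : ∀ z ∈ S, Int.gcd z.1 z.2 = e → ∃ a b : ℤ, z = (e * a, e * b) := by
      intro z _ hze
      obtain ⟨a, ha⟩ := (Int.gcd_dvd_left z.1 z.2)
      obtain ⟨b, hb⟩ := (Int.gcd_dvd_right z.1 z.2)
      rw [hze] at ha hb
      exact ⟨a, b, Prod.ext ha hb⟩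
    obtain ⟨a, b, hab⟩ := hdiv w hw hwe
    set M' := a ^ 2 + D * b ^ 2 with hM'
    have hMM : M = e ^ 2 * M' := by rw [← hww, hab]; simp only; ring
    have hM'0 : 0 < M' := by
      by_contra hneg
      have : 0 < (e : ℤ) ^ 2 := by positivity
      nlinarith
    have hcop : IsCoprime a b := by
      rw [hab] at hwe
      simp only at hwe
      rw [Int.gcd_mul_left] at hwe
      rw [Int.isCoprime_iff_gcd_eq_one]
      have : e ≠ 0 := by exact_mod_cast he0
      simpa [this] using hwe
    have hcM : IsCoprime M' b := by
      have h1 : IsCoprime (a ^ 2) b := hcop.pow_left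
      have : M' = a ^ 2 + (D * b) * b := by rw [hM']; ring
      rw [this]
      exact h1.add_mul_right_left _
    set T := S.filter (fun z => Int.gcd z.1 z.2 = e) with hT
    set f : ℤ × ℤ → ℤ × ℤ := fun z => (z.1 / e, z.2 / e) with hf
    have hfv : ∀ a b : ℤ, f (e * a, e * b) = (a, b) := by
      intro a b
      simp only [hf]
      rw [Int.mul_ediv_cancel_left _ he0, Int.mul_ediv_cancel_left _ he0]
    have hinj : Set.InjOn f T := by
      intro z hz y hy hzy
      obtain ⟨hz1, hz2⟩ := Finset.mem_filter.mp (Finset.mem_coe.mp hz)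
      obtain ⟨hy1, hy2⟩ := Finset.mem_filter.mp (Finset.mem_coe.mp hy)
      obtain ⟨a1, b1, rfl⟩ := hdiv z hz1 hz2
      obtain ⟨a2, b2, rfl⟩ := hdiv y hy1 hy2
      rw [hfv, hfv] at hzy
      rw [(Prod.mk.inj hzy).1, (Prod.mk.inj hzy).2]
    rw [← Finset.card_image_of_injOn hinj]
    refine (prim_bound D hD M' hM'0 (T.image f) ?_ (a, b) ?_ hcM).trans ?_
    · intro z hz
      obtain ⟨y, hy, rfl⟩ := Finset.mem_image.mp hz
      obtain ⟨hy1, hy2⟩ := Finset.mem_filter.mp hy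
      obtain ⟨a2, b2, rfl⟩ := hdiv y hy1 hy2
      have := hS _ hy1
      rw [hfv]
      simp only at this ⊢
      have h2 : (e : ℤ) ^ 2 * (a2 ^ 2 + D * b2 ^ 2) = e ^ 2 * M' := by rw [← hMM, ← this]; ring
      exact mul_left_cancel₀ (pow_ne_zero 2 he0) h2
    · rw [← hfv, ← hab]
      exact Finset.mem_image_of_mem _ (Finset.mem_filter.mpr ⟨hw, hwe⟩)
    · apply Nat.mul_le_mul_left
      apply Finset.card_le_card
      apply Nat.divisors_subset_of_dvd (by simpa using hM.ne')
      rw [hMM, Int.natAbs_mul]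
      exact dvd_mul_left _ _
  · apply Nat.mul_le_mul_left
    apply Finset.card_le_card
    intro e he
    obtain ⟨z, hz, rfl⟩ := Finset.mem_image.mp he
    rw [Nat.mem_divisors]
    refine ⟨?_, by simpa using hM.ne'⟩
    rw [← Int.natCast_dvd, ← hS z hz]
    exact dvd_add (dvd_pow (Int.gcd_dvd_left _ _) (by norm_num))
      (dvd_mul_of_dvd_right (dvd_pow (Int.gcd_dvd_right _ _) (by norm_num)) _)

lemma int_scale {ι : Type*} [Fintype ι] (v : ι → ℚ) :
    ∃ D : ℕ, D ≠ 0 ∧ ∃ V : ι → ℤ, ∀ i, (V i : ℚ) = D * v i := by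
  refine ⟨∏ i, (v i).den, Finset.prod_ne_zero_iff.mpr (fun i _ => (v i).den_nz), ?_⟩
  have : ∀ i, ∃ V : ℤ, (V : ℚ) = ((∏ i, (v i).den : ℕ) : ℚ) * v i := by
    intro i
    obtain ⟨c, hc⟩ := Finset.dvd_prod_of_mem (fun i => (v i).den) (Finset.mem_univ i)
    refine ⟨c * (v i).num, ?_⟩
    rw [hc]
    push_cast
    rw [mul_right_comm, Rat.den_mul_eq_num]
    ring
  choose V hV using this
  exact ⟨V, hV⟩

lemma two_dim {d : ℕ} (W : Submodule ℚ (Fin d → ℚ)) (hW : Module.finrank ℚ W = 2) :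
    ∃ V Z : Fin d → ℤ, (∑ i, V i * Z i = 0) ∧ (0 < ∑ i, V i * V i) ∧ (0 < ∑ i, Z i * Z i) ∧
      ∀ w ∈ W, ∃ α β : ℚ, ∀ i, w i = α * V i + β * Z i := by
  let b := Module.finBasisOfFinrankEq ℚ W hW
  set v : Fin d → ℚ := (b 0 : Fin d → ℚ) with hv
  set z : Fin d → ℚ := (b 1 : Fin d → ℚ) with hz
  have hli : ∀ x y : ℚ, x • v + y • z = 0 → x = 0 ∧ y = 0 := by
    intro x y hxy
    have h1 : x • b 0 + y • b 1 = 0 := Subtype.ext hxy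
    have hp : LinearIndependent ℚ ![b 0, b 1] := by
      convert b.linearIndependent using 1
      funext i; fin_cases i <;> rfl
    exact LinearIndependent.pair_iff.mp hp x y h1
  have pos : ∀ x : Fin d → ℚ, x ≠ 0 → 0 < ∑ i, x i * x i := by
    intro x hx
    obtain ⟨i, hi⟩ := Function.ne_iff.mp hx
    exact Finset.sum_pos' (fun i _ => mul_self_nonneg _) ⟨i, Finset.mem_univ _, mul_self_pos.mpr hi⟩
  set A : ℚ := ∑ i, v i * v i with hA
  set B : ℚ := ∑ i, v i * z i with hB
  have hA0 : 0 < A := pos v (fun h => by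
    have := (hli 1 0 (by simp [h])).1; norm_num at this)
  set z' : Fin d → ℚ := fun i => A * z i - B * v i with hz'
  have hz'0 : 0 < ∑ i, z' i * z' i := pos z' (fun h => by
    have := (hli (-B) A (by
      funext i
      have := congrFun h i
      simp only [hz', Pi.zero_apply] at this
      simp only [Pi.add_apply, Pi.smul_apply, smul_eq_mul, Pi.zero_apply]
      linarith)).2
    linarith)
  have horth : ∑ i, v i * z' i = 0 := by
    have : ∑ i, v i * z' i = A * B - B * A := by
      rw [hA, hB]
      conv_rhs => rw [Finset.mul_sum, Finset.mul_sum, ← Finset.sum_sub_distrib]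
      apply Finset.sum_congr rfl
      intro i _
      simp only [hz']
      ring
    rw [this]; ring
  obtain ⟨D1, hD1, V, hV⟩ := int_scale v
  obtain ⟨D2, hD2, Z, hZ⟩ := int_scale z'
  have hD1' : (0 : ℚ) < D1 := by positivity
  have hD2' : (0 : ℚ) < D2 := by positivity
  refine ⟨V, Z, ?_, ?_, ?_, ?_⟩
  · have : ((∑ i, V i * Z i : ℤ) : ℚ) = D1 * D2 * ∑ i, v i * z' i := by
      push_cast
      rw [Finset.mul_sum]
      exact Finset.sum_congr rfl (fun i _ => by rw [hV, hZ]; ring)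
    rw [horth, mul_zero] at this
    exact_mod_cast this
  · have : ((∑ i, V i * V i : ℤ) : ℚ) = D1 * D1 * ∑ i, v i * v i := by
      push_cast
      rw [Finset.mul_sum]
      exact Finset.sum_congr rfl (fun i _ => by rw [hV]; ring)
    have h2 : (0 : ℚ) < ((∑ i, V i * V i : ℤ) : ℚ) := by rw [this]; positivity
    exact_mod_cast h2
  · have : ((∑ i, Z i * Z i : ℤ) : ℚ) = D2 * D2 * ∑ i, z' i * z' i := by
      push_cast
      rw [Finset.mul_sum]
      exact Finset.sum_congr rfl (fun i _ => by rw [hZ]; ring)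
    have h2 : (0 : ℚ) < ((∑ i, Z i * Z i : ℤ) : ℚ) := by rw [this]; positivity
    exact_mod_cast h2
  · intro w hw
    have hrep := b.sum_repr ⟨w, hw⟩
    rw [Fin.sum_univ_two] at hrep
    set x := b.repr ⟨w, hw⟩ 0
    set y := b.repr ⟨w, hw⟩ 1
    refine ⟨(x + y * B / A) / D1, y / A / D2, fun i => ?_⟩
    have h1 : x * v i + y * z i = w i := congrFun (congrArg Subtype.val hrep) i
    rw [hV, hZ, ← h1]
    simp only [hz']
    field_simp
    ring

lemma count_two {d : ℕ} (ε : ℝ) (hε : 0 < ε) (W : Submodule ℚ (Fin d → ℚ))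
    (hW : Module.finrank ℚ W = 2) :
    ∃ C : ℝ, 0 < C ∧ ∀ lam : ℝ, 1 ≤ lam → ∀ S : Finset (Fin d → ℤ),
      (∀ n ∈ S, ∑ i, (n i : ℝ) ^ 2 = lam ^ 2) →
      (∀ n ∈ S, ∀ n' ∈ S, (fun i => (n i : ℚ) - n' i) ∈ W) →
      (S.card : ℝ) ≤ C * lam ^ ε := by
  obtain ⟨V, Z, hVZ, hA0, hC0, hsp⟩ := two_dim W hW
  obtain ⟨C0, hC01, hdiv⟩ := divisor_bound (ε / 4) (by positivity)
  set A : ℤ := ∑ i, V i * V i with hA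
  set C : ℤ := ∑ i, Z i * Z i with hC
  have hVZq : ∑ i, (V i : ℚ) * Z i = 0 := by exact_mod_cast hVZ
  have hAq : ∑ i, (V i : ℚ) * V i = A := by rw [hA]; push_cast; rfl
  have hCq : ∑ i, (Z i : ℚ) * Z i = C := by rw [hC]; push_cast; rfl
  set K : ℕ := (4 * (A * C) + 1).toNat * 2 with hK
  have hL0 : (0 : ℝ) < 2 * A ^ 2 * C := by
    have : (0 : ℝ) < A := by exact_mod_cast hA0
    have : (0 : ℝ) < C := by exact_mod_cast hC0
    positivity
  refine ⟨1 + K * C0 * C0 * (2 * A ^ 2 * C : ℝ) ^ (ε / 2), by positivity, ?_⟩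
  intro lam hlam S hS hSW
  have hlam1 : 1 ≤ lam ^ ε := Real.one_le_rpow hlam hε.le
  have hpos2 : 0 ≤ K * C0 * C0 * (2 * A ^ 2 * C : ℝ) ^ (ε / 2) := by positivity
  rcases S.eq_empty_or_nonempty with rfl | ⟨a, ha⟩
  · simp only [Finset.card_empty, Nat.cast_zero]; positivity
  set f : (Fin d → ℤ) → ℤ × ℤ := fun n => (A * ∑ i, Z i * n i, ∑ i, V i * n i) with hf
  -- coordinates of differences
  have hco : ∀ n ∈ S, ∀ n' ∈ S, ∃ α β : ℚ, (∀ i, (n i : ℚ) = n' i + α * V i + β * Z i) ∧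
      (∑ i, (V i : ℚ) * n i = ∑ i, (V i : ℚ) * n' i + α * A) ∧
      (∑ i, (Z i : ℚ) * n i = ∑ i, (Z i : ℚ) * n' i + β * C) := by
    intro n hn n' hn'
    obtain ⟨α, β, h⟩ := hsp _ (hSW n hn n' hn')
    have h' : ∀ i, (n i : ℚ) = n' i + α * V i + β * Z i := fun i => by linarith [h i]
    refine ⟨α, β, h', ?_, ?_⟩
    · calc _ = ∑ i, ((V i : ℚ) * n' i + α * (V i * V i) + β * (V i * Z i)) :=
            Finset.sum_congr rfl (fun i _ => by rw [h' i]; ring)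
        _ = _ := by
          rw [Finset.sum_add_distrib, Finset.sum_add_distrib, ← Finset.mul_sum, ← Finset.mul_sum,
            hVZq, hAq]; ring
    · calc _ = ∑ i, ((Z i : ℚ) * n' i + α * (V i * Z i) + β * (Z i * Z i)) :=
            Finset.sum_congr rfl (fun i _ => by rw [h' i]; ring)
        _ = _ := by
          rw [Finset.sum_add_distrib, Finset.sum_add_distrib, ← Finset.mul_sum, ← Finset.mul_sum,
            hVZq, hCq]; ring
  have hA0q : (A : ℚ) ≠ 0 := by exact_mod_cast hA0.ne'
  have hC0q : (C : ℚ) ≠ 0 := by exact_mod_cast hC0.ne'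
  have hinj : Set.InjOn f S := by
    intro n hn n' hn' hnn
    obtain ⟨α, β, h1, h2, h3⟩ := hco n hn n' hn'
    have e1 : A * ∑ i, Z i * n i = A * ∑ i, Z i * n' i := (Prod.mk.inj hnn).1
    have e2 : ∑ i, V i * n i = ∑ i, V i * n' i := (Prod.mk.inj hnn).2
    have e1 : ∑ i, Z i * n i = ∑ i, Z i * n' i := mul_left_cancel₀ hA0.ne' e1
    have e1' : ∑ i, (Z i : ℚ) * n i = ∑ i, (Z i : ℚ) * n' i := by exact_mod_cast e1
    have e2' : ∑ i, (V i : ℚ) * n i = ∑ i, (V i : ℚ) * n' i := by exact_mod_cast e2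
    have hα : α = 0 := by
      have : α * A = 0 := by linarith
      simpa [hA0q] using this
    have hβ : β = 0 := by
      have : β * C = 0 := by linarith
      simpa [hC0q] using this
    funext i
    have := h1 i
    rw [hα, hβ] at this
    simp only [zero_mul, add_zero] at this
    exact_mod_cast this
  have hnorm : ∀ n ∈ S, ∑ i, (n i : ℚ) ^ 2 = ∑ i, (a i : ℚ) ^ 2 := by
    intro n hn
    have := (hS n hn).trans (hS a ha).symm
    exact_mod_cast this
  set M : ℤ := (f a).1 ^ 2 + (A * C) * (f a).2 ^ 2 with hM
  have hconic : ∀ z ∈ S.image f, z.1 ^ 2 + (A * C) * z.2 ^ 2 = M := by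
    intro z hz
    obtain ⟨n, hn, rfl⟩ := Finset.mem_image.mp hz
    obtain ⟨α, β, h1, h2, h3⟩ := hco n hn a ha
    have h4 := hnorm n hn
    have h5 : ∑ i, (n i : ℚ) ^ 2 = ∑ i, (a i : ℚ) ^ 2 + 2 * α * ∑ i, (V i : ℚ) * a i
        + 2 * β * ∑ i, (Z i : ℚ) * a i + α ^ 2 * A + β ^ 2 * C := by
      calc _ = ∑ i, ((a i : ℚ) ^ 2 + 2 * α * (V i * a i) + 2 * β * (Z i * a i)
              + α ^ 2 * (V i * V i) + β ^ 2 * (Z i * Z i) + 2 * α * β * (V i * Z i)) :=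
            Finset.sum_congr rfl (fun i _ => by rw [h1 i]; ring)
        _ = _ := by
          simp only [Finset.sum_add_distrib, ← Finset.mul_sum]
          rw [hVZq, hCq, hAq]; ring
    have : ((A : ℚ) * ∑ i, (Z i : ℚ) * n i) ^ 2 + (A * C) * (∑ i, (V i : ℚ) * n i) ^ 2
        = ((A : ℚ) * ∑ i, (Z i : ℚ) * a i) ^ 2 + (A * C) * (∑ i, (V i : ℚ) * a i) ^ 2 := by
      rw [h2, h3]
      linear_combination (A : ℚ) ^ 2 * C * (h4 - h5)
    simp only [hM, hf]
    exact_mod_cast this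
  rw [← Finset.card_image_of_injOn hinj]
  have hACp : 0 < A * C := mul_pos hA0 hC0
  rcases lt_or_ge 0 M with hMp | hMn
  · have h1 := conic_bound (A * C) hACp M hMp _ hconic
    rw [← hK] at h1
    have hMabs : ((M.natAbs : ℕ) : ℝ) = M := by
      rw [Nat.cast_natAbs, abs_of_pos hMp]
    have h2 := hdiv M.natAbs (by simpa using hMp.ne')
    rw [hMabs] at h2
    have hMp' : (0 : ℝ) < M := by exact_mod_cast hMp
    have hMle : (M : ℝ) ≤ 2 * A ^ 2 * C * lam ^ 2 := by
      have c1 := Finset.sum_mul_sq_le_sq_mul_sq Finset.univ (fun i => (V i : ℝ)) (fun i => (a i : ℝ))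
      have c2 := Finset.sum_mul_sq_le_sq_mul_sq Finset.univ (fun i => (Z i : ℝ)) (fun i => (a i : ℝ))
      rw [hS a ha] at c1 c2
      have hAr : ∑ i, (V i : ℝ) ^ 2 = A := by rw [hA]; push_cast; simp only [sq]
      have hCr : ∑ i, (Z i : ℝ) ^ 2 = C := by rw [hC]; push_cast; simp only [sq]
      rw [hAr] at c1
      rw [hCr] at c2
      have hA0r : (0 : ℝ) < A := by exact_mod_cast hA0
      have hC0r : (0 : ℝ) < C := by exact_mod_cast hC0
      have : (M : ℝ) = (A : ℝ) ^ 2 * (∑ i, (Z i : ℝ) * a i) ^ 2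
          + (A * C) * (∑ i, (V i : ℝ) * a i) ^ 2 := by
        rw [hM]; simp only [hf]; push_cast; ring
      rw [this]
      have d1 := mul_le_mul_of_nonneg_left c2 (by positivity : (0 : ℝ) ≤ (A : ℝ) ^ 2)
      have d2 := mul_le_mul_of_nonneg_left c1 (by positivity : (0 : ℝ) ≤ (A * C : ℝ))
      linarith
    have h3 : ((M : ℝ) ^ (ε / 4)) * ((M : ℝ) ^ (ε / 4)) ≤ (2 * A ^ 2 * C : ℝ) ^ (ε / 2) * lam ^ ε := by
      rw [← Real.rpow_add hMp']
      calc (M : ℝ) ^ (ε / 4 + ε / 4) ≤ (2 * A ^ 2 * C * lam ^ 2 : ℝ) ^ (ε / 4 + ε / 4) :=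
            Real.rpow_le_rpow hMp'.le hMle (by positivity)
        _ = _ := by
          rw [Real.mul_rpow hL0.le (by positivity), ← Real.rpow_natCast lam 2,
            ← Real.rpow_mul (by positivity)]
          congr 2
          · ring
          · push_cast; ring
    have h1' : (((S.image f).card : ℕ) : ℝ) ≤ K * M.natAbs.divisors.card * M.natAbs.divisors.card := by
      exact_mod_cast h1
    calc _ ≤ _ := h1'
      _ ≤ K * (C0 * (M : ℝ) ^ (ε / 4)) * (C0 * (M : ℝ) ^ (ε / 4)) := by gcongr
      _ = K * C0 * C0 * ((M : ℝ) ^ (ε / 4) * (M : ℝ) ^ (ε / 4)) := by ring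
      _ ≤ K * C0 * C0 * ((2 * A ^ 2 * C : ℝ) ^ (ε / 2) * lam ^ ε) := by gcongr
      _ ≤ _ := by nlinarith
  · have : S.image f ⊆ {(0, 0)} := by
      intro z hz
      have h1 := hconic z hz
      have e1 : z.1 ^ 2 = 0 := by nlinarith [sq_nonneg z.1, sq_nonneg z.2, mul_nonneg hACp.le (sq_nonneg z.2)]
      have e2 : (A * C) * z.2 ^ 2 = 0 := by nlinarith [sq_nonneg z.1, mul_nonneg hACp.le (sq_nonneg z.2)]
      rw [Finset.mem_singleton]
      refine Prod.ext (by simpa using e1) ?_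
      rcases mul_eq_zero.mp e2 with h | h
      · omega
      · simpa using h
    have h1 := Finset.card_le_card this
    rw [Finset.card_singleton] at h1
    have h1' : (((S.image f).card : ℕ) : ℝ) ≤ 1 := by exact_mod_cast h1
    nlinarith

lemma count_gen {d : ℕ} (ε : ℝ) (hε : 0 < ε) (s : ℕ) : ∀ (W : Submodule ℚ (Fin d → ℚ))
    (_ : Module.finrank ℚ W = s + 2),
    ∃ C : ℝ, 0 < C ∧ ∀ lam : ℝ, 1 ≤ lam → ∀ S : Finset (Fin d → ℤ),
      (∀ n ∈ S, ∑ i, (n i : ℝ) ^ 2 = lam ^ 2) →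
      (∀ n ∈ S, ∀ n' ∈ S, (fun i => (n i : ℚ) - n' i) ∈ W) →
      (S.card : ℝ) ≤ C * lam ^ ((s : ℝ) + ε) := by
  induction s with
  | zero =>
    intro W hW
    simpa using count_two ε hε W (by simpa using hW)
  | succ s ih =>
    intro W hW
    have hex : ∃ i : Fin d, ((LinearMap.proj i : (Fin d → ℚ) →ₗ[ℚ] ℚ) ∘ₗ W.subtype) ≠ 0 := by
      by_contra hcon
      push Not at hcon
      have : W = ⊥ := by
        rw [eq_bot_iff]
        intro w hw
        rw [Submodule.mem_bot]
        funext i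
        exact LinearMap.congr_fun (hcon i) ⟨w, hw⟩
      rw [this] at hW
      simp at hW
    obtain ⟨i, hi⟩ := hex
    set g : Module.Dual ℚ W := (LinearMap.proj i : (Fin d → ℚ) →ₗ[ℚ] ℚ) ∘ₗ W.subtype with hg
    have hr := Module.Dual.finrank_ker_add_one_of_ne_zero hi
    obtain ⟨C, hC, hb⟩ := ih ((LinearMap.ker g).map W.subtype) (by
      rw [Submodule.finrank_map_subtype_eq]; omega)
    refine ⟨3 * C, by positivity, ?_⟩
    intro lam hlam S hS hSW
    have hlam0 : 0 < lam := by linarith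
    have himg : S.image (fun n => n i) ⊆ Finset.Icc (-⌊lam⌋) ⌊lam⌋ := by
      intro x hx
      obtain ⟨n, hn, rfl⟩ := Finset.mem_image.mp hx
      have h1 := hS n hn
      have h2 : (n i : ℝ) ^ 2 ≤ lam ^ 2 := by
        rw [← h1]
        exact Finset.single_le_sum (f := fun i => (n i : ℝ) ^ 2) (fun _ _ => sq_nonneg _) (Finset.mem_univ i)
      have h3 := abs_le.mp (abs_le_of_sq_le_sq h2 hlam0.le)
      rw [Finset.mem_Icc]
      constructor
      · have : -(n i) ≤ ⌊lam⌋ := Int.le_floor.mpr (by push_cast; linarith)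
        linarith
      · exact Int.le_floor.mpr h3.2
    have hcard : ((S.image (fun n => n i)).card : ℝ) ≤ 3 * lam := by
      have h1 := Finset.card_le_card himg
      rw [Int.card_Icc] at h1
      have hf : 0 ≤ ⌊lam⌋ := Int.floor_nonneg.mpr hlam0.le
      have h2 : ((S.image (fun n => n i)).card : ℤ) ≤ 2 * ⌊lam⌋ + 1 := by omega
      have h3 : ((S.image (fun n => n i)).card : ℝ) ≤ 2 * (⌊lam⌋ : ℝ) + 1 := by exact_mod_cast h2
      have := Int.floor_le lam
      linarith
    have hfib : ∀ x ∈ S.image (fun n => n i),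
        ((S.filter (fun n => n i = x)).card : ℝ) ≤ C * lam ^ ((s : ℝ) + ε) := by
      intro x _
      apply hb lam hlam
      · intro n hn
        exact hS n (Finset.mem_filter.mp hn).1
      · intro n hn n' hn'
        obtain ⟨h1, h2⟩ := Finset.mem_filter.mp hn
        obtain ⟨h3, h4⟩ := Finset.mem_filter.mp hn'
        refine ⟨⟨_, hSW n h1 n' h3⟩, ?_, rfl⟩
        change (n i : ℚ) - n' i = 0
        rw [h2, h4]; ring
    rw [Finset.card_eq_sum_card_image (fun n => n i) S]
    push_cast
    calc _ ≤ ∑ x ∈ S.image (fun n => n i), C * lam ^ ((s : ℝ) + ε) := Finset.sum_le_sum hfib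
      _ = ((S.image (fun n => n i)).card : ℝ) * (C * lam ^ ((s : ℝ) + ε)) := by
        rw [Finset.sum_const, nsmul_eq_mul]
      _ ≤ (3 * lam) * (C * lam ^ ((s : ℝ) + ε)) := by gcongr
      _ = 3 * C * (lam ^ (1 : ℝ) * lam ^ ((s : ℝ) + ε)) := by rw [Real.rpow_one]; ring
      _ = _ := by rw [← Real.rpow_add hlam0]; congr 2; ring

lemma one_dim_int (q : ℕ) (hq : 0 < q) (l : ℤ) :
    ∫ t in Set.Icc (-(Real.pi * q)) (Real.pi * q), Complex.exp (Complex.I * (t * (l / q : ℝ) : ℝ))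
      = if l = 0 then ((2 * Real.pi * q : ℝ) : ℂ) else 0 := by
  have hq' : (q : ℂ) ≠ 0 := by exact_mod_cast hq.ne'
  have hR : -(Real.pi * q) ≤ Real.pi * q := by have := Real.pi_pos; nlinarith [this, (Nat.cast_nonneg q : (0:ℝ) ≤ q)]
  rw [integral_Icc_eq_integral_Ioc, ← intervalIntegral.integral_of_le hR]
  split_ifs with h
  · subst h
    simp
    ring
  · have hl : (l : ℂ) ≠ 0 := by exact_mod_cast h
    have hc : Complex.I * (l / q : ℂ) ≠ 0 := mul_ne_zero Complex.I_ne_zero (div_ne_zero hl hq')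
    have e : ∀ t : ℝ, Complex.exp (Complex.I * (t * (l / q : ℝ) : ℝ))
        = Complex.exp ((Complex.I * (l / q : ℂ)) * t) := by
      intro t; congr 1; push_cast; ring
    simp_rw [e]
    rw [integral_exp_mul_complex hc, div_eq_zero_iff]
    left
    rw [sub_eq_zero, Complex.exp_eq_exp_iff_exists_int]
    refine ⟨l, ?_⟩
    push_cast
    field_simp
    ring

lemma box_bound (k q : ℕ) (hq : 0 < q) {ι : Type*} (E : Finset ι) (b : ι → ℂ)
    (m : ι → Fin k → ℤ) :
    ∫ t in Set.univ.pi (fun _ : Fin k => Set.Icc (-1 : ℝ) 1),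
      ‖∑ n ∈ E, b n * Complex.exp (Complex.I * (∑ j, t j * (m n j / q : ℝ) : ℝ))‖ ^ 2
    ≤ (2 * Real.pi * q) ^ k *
      ∑ n ∈ E, ∑ n' ∈ E, if m n = m n' then ‖b n‖ * ‖b n'‖ else 0 := by
  have hq1 : (1 : ℝ) ≤ q := by exact_mod_cast hq
  have hR : 1 ≤ Real.pi * q := by nlinarith [Real.pi_gt_three]
  set F : (Fin k → ℝ) → ℂ := fun t =>
    ∑ n ∈ E, b n * Complex.exp (Complex.I * (∑ j, t j * (m n j / q : ℝ) : ℝ)) with hF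
  set Bx : Set (Fin k → ℝ) := Set.univ.pi (fun _ : Fin k => Set.Icc (-(Real.pi * q)) (Real.pi * q))
    with hBx
  have hBc : IsCompact Bx := isCompact_univ_pi (fun _ => isCompact_Icc)
  have hFc : Continuous F := by rw [hF]; fun_prop
  have step1 : ∫ t in Set.univ.pi (fun _ : Fin k => Set.Icc (-1 : ℝ) 1), ‖F t‖ ^ 2
      ≤ ∫ t in Bx, ‖F t‖ ^ 2 := by
    apply setIntegral_mono_set
    · exact (hFc.norm.pow 2).continuousOn.integrableOn_compact hBc
    · exact Filter.Eventually.of_forall (fun t => sq_nonneg _)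
    · apply LE.le.eventuallyLE
      exact Set.pi_mono (fun _ _ => Set.Icc_subset_Icc (by linarith) hR)
  refine step1.trans ?_
  have expand : ∀ t, ((‖F t‖ ^ 2 : ℝ) : ℂ) = ∑ n ∈ E, ∑ n' ∈ E, (b n * (starRingEnd ℂ) (b n')) *
      ∏ j, Complex.exp (Complex.I * (t j * ((m n j - m n' j : ℤ) / q : ℝ) : ℝ)) := by
    intro t
    have : ((‖F t‖ ^ 2 : ℝ) : ℂ) = F t * (starRingEnd ℂ) (F t) := by
      rw [Complex.mul_conj, Complex.normSq_eq_norm_sq]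
    rw [this]
    simp only [hF]
    rw [map_sum, Finset.sum_mul_sum]
    refine Finset.sum_congr rfl fun n _ => Finset.sum_congr rfl fun n' _ => ?_
    rw [map_mul, mul_mul_mul_comm, ← Complex.exp_conj, ← Complex.exp_add, ← Complex.exp_sum]
    congr 2
    rw [map_mul, Complex.conj_I, Complex.conj_ofReal]
    push_cast
    rw [← Finset.mul_sum, neg_mul, ← sub_eq_add_neg, ← mul_sub, ← Finset.sum_sub_distrib]
    congr 1
    refine Finset.sum_congr rfl fun j _ => ?_
    ring
  have hprod : ∀ n n', ∫ t in Bx,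
      ∏ j, Complex.exp (Complex.I * (t j * ((m n j - m n' j : ℤ) / q : ℝ) : ℝ))
      = if m n = m n' then (((2 * Real.pi * q) ^ k : ℝ) : ℂ) else 0 := by
    intro n n'
    rw [hBx, volume_pi, Measure.restrict_pi_pi,
      integral_fintype_prod_eq_prod (fun j (s : ℝ) =>
        Complex.exp (Complex.I * (s * ((m n j - m n' j : ℤ) / q : ℝ) : ℝ)))]
    simp_rw [one_dim_int q hq]
    split_ifs with h
    · rw [h]; simp
    · obtain ⟨j, hj⟩ := Function.ne_iff.mp h
      exact Finset.prod_eq_zero (Finset.mem_univ j) (by rw [if_neg (sub_ne_zero.mpr hj)])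
  have hint : ∀ n n', IntegrableOn (fun t : Fin k → ℝ => (b n * (starRingEnd ℂ) (b n')) *
      ∏ j, Complex.exp (Complex.I * (t j * ((m n j - m n' j : ℤ) / q : ℝ) : ℝ))) Bx := by
    intro n n'
    refine ContinuousOn.integrableOn_compact hBc (Continuous.continuousOn ?_)
    fun_prop
  have val : ((∫ t in Bx, ‖F t‖ ^ 2 : ℝ) : ℂ) = ∑ n ∈ E, ∑ n' ∈ E,
      (b n * (starRingEnd ℂ) (b n')) * if m n = m n' then (((2 * Real.pi * q) ^ k : ℝ) : ℂ) else 0 := by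
    rw [← integral_complex_ofReal]
    simp_rw [expand]
    rw [integral_finsetSum _ (fun n _ => integrable_finsetSum _ (fun n' _ => hint n n'))]
    refine Finset.sum_congr rfl fun n _ => ?_
    rw [integral_finsetSum _ (fun n' _ => hint n n')]
    refine Finset.sum_congr rfl fun n' _ => ?_
    rw [integral_const_mul, hprod]
  calc ∫ t in Bx, ‖F t‖ ^ 2 ≤ ‖((∫ t in Bx, ‖F t‖ ^ 2 : ℝ) : ℂ)‖ := by
        rw [Complex.norm_real]; exact le_abs_self _
    _ ≤ ∑ n ∈ E, ∑ n' ∈ E, (2 * Real.pi * q) ^ k * if m n = m n' then ‖b n‖ * ‖b n'‖ else 0 := by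
        rw [val]
        refine (norm_sum_le _ _).trans (Finset.sum_le_sum fun n _ => (norm_sum_le _ _).trans
          (Finset.sum_le_sum fun n' _ => ?_))
        split_ifs
        · rw [norm_mul, norm_mul, RCLike.norm_conj, Complex.norm_real, Real.norm_of_nonneg (by positivity)]
          exact le_of_eq (by ring)
        · simp
    _ = _ := by simp_rw [Finset.mul_sum]

lemma schur {ι κ : Type*} [DecidableEq κ] (E : Finset ι) (x : ι → ℝ) (m : ι → κ) (B : ℝ)
    (hB : ∀ n ∈ E, ((E.filter (fun n' => m n = m n')).card : ℝ) ≤ B) :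
    ∑ n ∈ E, ∑ n' ∈ E, (if m n = m n' then x n * x n' else 0) ≤ B * ∑ n ∈ E, x n ^ 2 := by
  have h1 : ∑ n ∈ E, ∑ n' ∈ E, (if m n = m n' then x n ^ 2 else 0) ≤ B * ∑ n ∈ E, x n ^ 2 := by
    rw [Finset.mul_sum]
    refine Finset.sum_le_sum fun n hn => ?_
    rw [← Finset.sum_filter, Finset.sum_const, nsmul_eq_mul]
    exact mul_le_mul_of_nonneg_right (hB n hn) (sq_nonneg _)
  have h2 : ∑ n ∈ E, ∑ n' ∈ E, (if m n = m n' then x n' ^ 2 else 0) =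
      ∑ n ∈ E, ∑ n' ∈ E, (if m n = m n' then x n ^ 2 else 0) := by
    rw [Finset.sum_comm]
    simp_rw [eq_comm]
  have h3 : ∑ n ∈ E, ∑ n' ∈ E, (if m n = m n' then x n * x n' else 0) ≤
      ∑ n ∈ E, ∑ n' ∈ E, ((if m n = m n' then x n ^ 2 else 0) / 2 +
        (if m n = m n' then x n' ^ 2 else 0) / 2) := by
    refine Finset.sum_le_sum fun n _ => Finset.sum_le_sum fun n' _ => ?_
    split_ifs
    · nlinarith [sq_nonneg (x n - x n')]
    · simp
  simp only [Finset.sum_add_distrib, ← Finset.sum_div] at h3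
  rw [h2] at h3
  linarith

theorem stmt9 (d k : ℕ) (hd : 3 ≤ d) (hk1 : 1 ≤ k) (hk2 : k ≤ d - 2)
    (ε : ℝ) (hε : 0 < ε) (u : Fin k → Fin d → ℚ) (hu : LinearIndependent ℚ u) :
    ∃ C : ℝ, 0 < C ∧
      ∀ (lam : ℝ), 1 ≤ lam →
        ∀ (E : Finset (Fin d → ℤ)),
          (∀ n : Fin d → ℤ, n ∈ E ↔ (∑ i, ((n i : ℝ)) ^ 2) = lam ^ 2) →
            ∀ (c : (Fin d → ℤ) → ℂ) (x₀ : Fin d → ℝ),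
              Real.sqrt (Matrix.det (Matrix.of fun i j : Fin k =>
                  ∑ l, (u i l : ℝ) * (u j l : ℝ))) *
                (∫ t in Set.univ.pi (fun _ : Fin k => Set.Icc (-1 : ℝ) 1),
                  ‖∑ n ∈ E, c n *
                    Complex.exp (Complex.I * (dotIR n (fun i =>
                      x₀ i + ∑ j, t j * (u j i : ℝ)) : ℂ))‖ ^ 2)
                ≤ C * lam ^ ((d : ℝ) - k - 2 + ε) * ∑ n ∈ E, ‖c n‖ ^ 2 := by
  classical
  obtain ⟨q, hq, U, hU⟩ := int_scale (fun p : Fin k × Fin d => u p.1 p.2)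
  have hqpos : 0 < q := Nat.pos_of_ne_zero hq
  have hqr : (q : ℝ) ≠ 0 := by exact_mod_cast hq
  have hUr : ∀ j i, (U (j, i) : ℝ) = q * (u j i : ℝ) := by
    intro j i
    have := hU (j, i)
    simp only at this
    exact_mod_cast congrArg (fun x : ℚ => (x : ℝ)) this
  set W : Submodule ℚ (Fin d → ℚ) := LinearMap.ker (Matrix.mulVecLin (Matrix.of u)) with hW
  have hrank : (Matrix.of u).rank = k := by
    have : LinearIndependent ℚ (Matrix.of u).row := hu
    simpa using this.rank_matrix
  have hWr : Module.finrank ℚ W = (d - k - 2) + 2 := by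
    have h1 := LinearMap.finrank_range_add_finrank_ker (Matrix.mulVecLin (Matrix.of u))
    have h2 : Module.finrank ℚ (LinearMap.range (Matrix.mulVecLin (Matrix.of u))) = k := hrank
    rw [h2, Module.finrank_fin_fun] at h1
    rw [hW]
    omega
  obtain ⟨C, hC, hcount⟩ := count_gen ε hε (d - k - 2) W hWr
  have hexp : (((d - k - 2 : ℕ) : ℝ) + ε) = (d : ℝ) - k - 2 + ε := by
    have : d = (d - k - 2) + k + 2 := by omega
    have h : (d : ℝ) = ((d - k - 2 : ℕ) : ℝ) + k + 2 := by exact_mod_cast this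
    linarith
  rw [hexp] at hcount
  set G : ℝ := Real.sqrt (Matrix.det (Matrix.of fun i j : Fin k =>
                  ∑ l, (u i l : ℝ) * (u j l : ℝ))) with hG
  have hG0 : 0 ≤ G := Real.sqrt_nonneg _
  refine ⟨(G + 1) * (2 * Real.pi * q) ^ k * C, by positivity, ?_⟩
  intro lam hlam E hE c x₀
  set m : (Fin d → ℤ) → Fin k → ℤ := fun n j => ∑ i, n i * U (j, i) with hm
  set b : (Fin d → ℤ) → ℂ := fun n => c n * Complex.exp (Complex.I * (dotIR n x₀ : ℝ)) with hb
  have hbn : ∀ n, ‖b n‖ = ‖c n‖ := by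
    intro n
    rw [hb]
    simp only [norm_mul]
    rw [mul_comm Complex.I, Complex.norm_exp_ofReal_mul_I, mul_one]
  have hrew : ∀ t : Fin k → ℝ, ∑ n ∈ E, c n * Complex.exp (Complex.I * (dotIR n (fun i =>
                      x₀ i + ∑ j, t j * (u j i : ℝ)) : ℂ))
      = ∑ n ∈ E, b n * Complex.exp (Complex.I * (∑ j, t j * (m n j / q : ℝ) : ℝ)) := by
    intro t
    refine Finset.sum_congr rfl fun n _ => ?_
    rw [hb]
    simp only
    rw [mul_assoc, ← Complex.exp_add, ← mul_add, ← Complex.ofReal_add]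
    congr 4
    simp only [dotIR, mul_add, Finset.sum_add_distrib]
    congr 1
    simp_rw [Finset.mul_sum]
    rw [Finset.sum_comm]
    refine Finset.sum_congr rfl fun j _ => ?_
    simp only [hm]
    push_cast
    rw [Finset.sum_div, Finset.mul_sum]
    refine Finset.sum_congr rfl fun i _ => ?_
    rw [hUr]
    field_simp
  simp_rw [hrew]
  have h1 := box_bound k q hqpos E b m
  have h2 := schur E (fun n => ‖b n‖) m (C * lam ^ ((d : ℝ) - k - 2 + ε)) (by
    intro n₀ _
    apply hcount lam hlam
    · intro n hn
      exact (hE n).mp (Finset.mem_filter.mp hn).1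
    · intro n hn n' hn'
      have e1 := (Finset.mem_filter.mp hn).2
      have e2 := (Finset.mem_filter.mp hn').2
      have e3 : m n = m n' := e1.symm.trans e2
      rw [hW, LinearMap.mem_ker, Matrix.mulVecLin_apply]
      funext j
      have e4 : ∑ i, n i * U (j, i) = ∑ i, n' i * U (j, i) := congrFun e3 j
      have e5 : ∑ i, (n i : ℚ) * U (j, i) = ∑ i, (n' i : ℚ) * U (j, i) := by exact_mod_cast e4
      have hqq : (q : ℚ) ≠ 0 := by exact_mod_cast hq
      have e6 : (q : ℚ) * ∑ i, u j i * ((n i : ℚ) - n' i) = 0 := by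
        rw [Finset.mul_sum, ← sub_eq_zero.mpr e5, ← Finset.sum_sub_distrib]
        refine Finset.sum_congr rfl fun i _ => ?_
        rw [hU (j, i)]; ring
      have e7 := (mul_eq_zero.mp e6).resolve_left hqq
      simpa [Matrix.mulVec, dotProduct] using e7)
  simp only [hbn] at h1 h2
  have hs : 0 ≤ ∑ n ∈ E, ‖c n‖ ^ 2 := Finset.sum_nonneg fun _ _ => sq_nonneg _
  have hlp : 0 ≤ lam ^ ((d : ℝ) - k - 2 + ε) := by positivity
  have hP : (0 : ℝ) ≤ (2 * Real.pi * q) ^ k := by positivity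
  calc _ ≤ G * ((2 * Real.pi * q) ^ k * (C * lam ^ ((d : ℝ) - k - 2 + ε) * ∑ n ∈ E, ‖c n‖ ^ 2)) := by
        apply mul_le_mul_of_nonneg_left _ hG0
        exact h1.trans (mul_le_mul_of_nonneg_left h2 hP)
    _ ≤ (G + 1) * ((2 * Real.pi * q) ^ k * (C * lam ^ ((d : ℝ) - k - 2 + ε) * ∑ n ∈ E, ‖c n‖ ^ 2)) := by
        apply mul_le_mul_of_nonneg_right (by linarith)
        positivity
    _ = _ := by ring
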